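/- For every valid online rotation strategy σ and every integer n ≥ 1, there exists a stream L of n² + 1 pieces, each of whose two edge lengths is at least 1, such that OPT(L) ≤ 2n² and ALG_σ(L) ≥ n^{5/2}, where the cost is the area of the bounding box. In particular, any competitive ratio of an online algorithm for area minimization with rotations allowed, expressed as a function of OPT, is Ω(OPT^{1/4}), even when all edges have length at least 1. -/

import Mathlib

open Set

/-- A piece is a pair (w,h) of (intended positive) real numbers. -/
abbrev Piece := ℝ × ℝ

/-- Both edge lengths of the piece are positive. -/
def PiecePos (p : Piece) : Prop := 0 < p.1 ∧ 0 < p.2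

/-- The axis-parallel closed rectangle obtained by placing piece `p` by
translation at the point `q`. -/
def placedRect (p : Piece) (q : ℝ × ℝ) : Set (ℝ × ℝ) :=
  Set.Icc q.1 (q.1 + p.1) ×ˢ Set.Icc q.2 (q.2 + p.2)

/-- Width of the axis-parallel bounding box of a set in the plane. -/
noncomputable def boxWidth (S : Set (ℝ × ℝ)) : ℝ :=
  sSup (Prod.fst '' S) - sInf (Prod.fst '' S)

/-- Height of the axis-parallel bounding box of a set in the plane. -/
noncomputable def boxHeight (S : Set (ℝ × ℝ)) : ℝ :=
  sSup (Prod.snd '' S) - sInf (Prod.snd '' S)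

/-! ### Translations only -/

/-- `pos` is a packing (by translations) of the list `L` of pieces:
the placed rectangles have pairwise disjoint interiors. -/
def IsPacking (L : List Piece) (pos : Fin L.length → ℝ × ℝ) : Prop :=
  ∀ i j : Fin L.length, i ≠ j →
    Disjoint (interior (placedRect (L.get i) (pos i)))
             (interior (placedRect (L.get j) (pos j)))

/-- The union of the placed rectangles. -/
def packedSet (L : List Piece) (pos : Fin L.length → ℝ × ℝ) : Set (ℝ × ℝ) :=
  ⋃ i : Fin L.length, placedRect (L.get i) (pos i)

/-- Perimeter of the bounding box of a packing. -/
noncomputable def periCost (L : List Piece) (pos : Fin L.length → ℝ × ℝ) : ℝ :=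
  2 * (boxWidth (packedSet L pos) + boxHeight (packedSet L pos))

/-- Area of the bounding box of a packing. -/
noncomputable def areaCost (L : List Piece) (pos : Fin L.length → ℝ × ℝ) : ℝ :=
  boxWidth (packedSet L pos) * boxHeight (packedSet L pos)

/-- Optimal offline bounding-box perimeter for the pieces of `L`. -/
noncomputable def optPeri (L : List Piece) : ℝ :=
  sInf { c | ∃ pos : Fin L.length → ℝ × ℝ, IsPacking L pos ∧ periCost L pos = c }

/-- Optimal offline bounding-box area for the pieces of `L`. -/
noncomputable def optArea (L : List Piece) : ℝ :=
  sInf { c | ∃ pos : Fin L.length → ℝ × ℝ, IsPacking L pos ∧ areaCost L pos = c }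

/-- The positions chosen by the online strategy `σ` on the stream `L`:
the `i`-th piece is placed at the point chosen by `σ` as a function of the
first `i+1` pieces. -/
def onlinePos (σ : List Piece → ℝ × ℝ) (L : List Piece) :
    Fin L.length → ℝ × ℝ :=
  fun i => σ (L.take ((i : ℕ) + 1))

/-- `σ` is a valid online translation strategy: on every stream of pieces it
produces a packing. -/
def StrategyValid (σ : List Piece → ℝ × ℝ) : Prop :=
  ∀ L : List Piece, (∀ p ∈ L, PiecePos p) → IsPacking L (onlinePos σ L)

/-- Perimeter of the bounding box of the packing produced by `σ` on `L`. -/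
noncomputable def algPeri (σ : List Piece → ℝ × ℝ) (L : List Piece) : ℝ :=
  periCost L (onlinePos σ L)

/-- Area of the bounding box of the packing produced by `σ` on `L`. -/
noncomputable def algArea (σ : List Piece → ℝ × ℝ) (L : List Piece) : ℝ :=
  areaCost L (onlinePos σ L)

/-! ### Rotations by 90° allowed -/

/-- The piece `p` in the orientation given by `r`: rotated by 90° if `r` is
`true`. -/
def orient (p : Piece) (r : Bool) : Piece := if r then (p.2, p.1) else p

/-- `pos, rot` is a packing with rotations of the list `L` of pieces. -/
def IsRotPacking (L : List Piece) (pos : Fin L.length → ℝ × ℝ)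
    (rot : Fin L.length → Bool) : Prop :=
  ∀ i j : Fin L.length, i ≠ j →
    Disjoint (interior (placedRect (orient (L.get i) (rot i)) (pos i)))
             (interior (placedRect (orient (L.get j) (rot j)) (pos j)))

/-- The union of the placed (possibly rotated) rectangles. -/
def packedRotSet (L : List Piece) (pos : Fin L.length → ℝ × ℝ)
    (rot : Fin L.length → Bool) : Set (ℝ × ℝ) :=
  ⋃ i : Fin L.length, placedRect (orient (L.get i) (rot i)) (pos i)

/-- Perimeter of the bounding box of a packing with rotations. -/
noncomputable def periRotCost (L : List Piece) (pos : Fin L.length → ℝ × ℝ)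
    (rot : Fin L.length → Bool) : ℝ :=
  2 * (boxWidth (packedRotSet L pos rot) + boxHeight (packedRotSet L pos rot))

/-- Area of the bounding box of a packing with rotations. -/
noncomputable def areaRotCost (L : List Piece) (pos : Fin L.length → ℝ × ℝ)
    (rot : Fin L.length → Bool) : ℝ :=
  boxWidth (packedRotSet L pos rot) * boxHeight (packedRotSet L pos rot)

/-- Optimal offline bounding-box perimeter with rotations allowed. -/
noncomputable def optRotPeri (L : List Piece) : ℝ :=
  sInf { c | ∃ (pos : Fin L.length → ℝ × ℝ) (rot : Fin L.length → Bool),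
    IsRotPacking L pos rot ∧ periRotCost L pos rot = c }

/-- Optimal offline bounding-box area with rotations allowed. -/
noncomputable def optRotArea (L : List Piece) : ℝ :=
  sInf { c | ∃ (pos : Fin L.length → ℝ × ℝ) (rot : Fin L.length → Bool),
    IsRotPacking L pos rot ∧ areaRotCost L pos rot = c }

/-- The positions chosen by the online rotation strategy `σ` on the stream `L`. -/
def onlineRotPos (σ : List Piece → (ℝ × ℝ) × Bool) (L : List Piece) :
    Fin L.length → ℝ × ℝ :=
  fun i => (σ (L.take ((i : ℕ) + 1))).1

/-- The orientations chosen by the online rotation strategy `σ` on the stream `L`. -/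
def onlineRot (σ : List Piece → (ℝ × ℝ) × Bool) (L : List Piece) :
    Fin L.length → Bool :=
  fun i => (σ (L.take ((i : ℕ) + 1))).2

/-- `σ` is a valid online rotation strategy: on every stream of pieces it
produces a packing with rotations. -/
def RotStrategyValid (σ : List Piece → (ℝ × ℝ) × Bool) : Prop :=
  ∀ L : List Piece, (∀ p ∈ L, PiecePos p) →
    IsRotPacking L (onlineRotPos σ L) (onlineRot σ L)

/-- Perimeter of the bounding box of the packing produced by `σ` on `L`. -/
noncomputable def algRotPeri (σ : List Piece → (ℝ × ℝ) × Bool) (L : List Piece) : ℝ :=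
  periRotCost L (onlineRotPos σ L) (onlineRot σ L)

/-- Area of the bounding box of the packing produced by `σ` on `L`. -/
noncomputable def algRotArea (σ : List Piece → (ℝ × ℝ) × Bool) (L : List Piece) : ℝ :=
  areaRotCost L (onlineRotPos σ L) (onlineRot σ L)

/-! ### Square pieces, bounding-square cost -/

/-- The axis-parallel closed square of side `s` placed at the point `q`. -/
def placedSq (s : ℝ) (q : ℝ × ℝ) : Set (ℝ × ℝ) :=
  Set.Icc q.1 (q.1 + s) ×ˢ Set.Icc q.2 (q.2 + s)

/-- `pos` is a packing of the list `L` of square pieces. -/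
def IsSqPacking (L : List ℝ) (pos : Fin L.length → ℝ × ℝ) : Prop :=
  ∀ i j : Fin L.length, i ≠ j →
    Disjoint (interior (placedSq (L.get i) (pos i)))
             (interior (placedSq (L.get j) (pos j)))

/-- The union of the placed squares. -/
def packedSqSet (L : List ℝ) (pos : Fin L.length → ℝ × ℝ) : Set (ℝ × ℝ) :=
  ⋃ i : Fin L.length, placedSq (L.get i) (pos i)

/-- Area of the smallest axis-parallel square containing all placed squares. -/
noncomputable def sqCost (L : List ℝ) (pos : Fin L.length → ℝ × ℝ) : ℝ :=
  (max (boxWidth (packedSqSet L pos)) (boxHeight (packedSqSet L pos))) ^ 2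

/-- Optimal offline bounding-square area for the square pieces of `L`. -/
noncomputable def optSq (L : List ℝ) : ℝ :=
  sInf { c | ∃ pos : Fin L.length → ℝ × ℝ, IsSqPacking L pos ∧ sqCost L pos = c }

/-- The positions chosen by the online strategy `σ` on the stream `L` of
square pieces. -/
def onlineSqPos (σ : List ℝ → ℝ × ℝ) (L : List ℝ) : Fin L.length → ℝ × ℝ :=
  fun i => σ (L.take ((i : ℕ) + 1))

/-- `σ` is a valid online translation strategy for square pieces. -/
def SqStrategyValid (σ : List ℝ → ℝ × ℝ) : Prop :=
  ∀ L : List ℝ, (∀ s ∈ L, 0 < s) → IsSqPacking L (onlineSqPos σ L)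

/-- Bounding-square area of the packing produced by `σ` on `L`. -/
noncomputable def algSq (σ : List ℝ → ℝ × ℝ) (L : List ℝ) : ℝ :=
  sqCost L (onlineSqPos σ L)

/-! ### Bounding boxes -/

lemma boxWidth_mono {S T : Set (ℝ × ℝ)} (hS : S.Nonempty) (hT : Bornology.IsBounded T)
    (h : S ⊆ T) : boxWidth S ≤ boxWidth T :=
  sub_le_sub (csSup_le_csSup hT.image_fst.bddAbove (hS.image _) (image_mono h))
    (csInf_le_csInf hT.image_fst.bddBelow (hS.image _) (image_mono h))

lemma boxHeight_mono {S T : Set (ℝ × ℝ)} (hS : S.Nonempty) (hT : Bornology.IsBounded T)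
    (h : S ⊆ T) : boxHeight S ≤ boxHeight T :=
  sub_le_sub (csSup_le_csSup hT.image_snd.bddAbove (hS.image _) (image_mono h))
    (csInf_le_csInf hT.image_snd.bddBelow (hS.image _) (image_mono h))

lemma boxWidth_nonneg {S : Set (ℝ × ℝ)} (hS : Bornology.IsBounded S) : 0 ≤ boxWidth S :=
  sub_nonneg.2 (Real.sInf_le_sSup _ hS.image_fst.bddBelow hS.image_fst.bddAbove)

lemma boxHeight_nonneg {S : Set (ℝ × ℝ)} (hS : Bornology.IsBounded S) : 0 ≤ boxHeight S :=
  sub_nonneg.2 (Real.sInf_le_sSup _ hS.image_snd.bddBelow hS.image_snd.bddAbove)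

lemma isBounded_placedRect (p : Piece) (q : ℝ × ℝ) : Bornology.IsBounded (placedRect p q) :=
  (Metric.isBounded_Icc _ _).prod (Metric.isBounded_Icc _ _)

lemma placedRect_nonempty {p : Piece} (hp : PiecePos p) (q : ℝ × ℝ) :
    (placedRect p q).Nonempty :=
  ⟨q, by simp [hp.1.le], by simp [hp.2.le]⟩

lemma boxWidth_placedRect {p : Piece} (hp : PiecePos p) (q : ℝ × ℝ) :
    boxWidth (placedRect p q) = p.1 := by
  have h₁ : q.1 ≤ q.1 + p.1 := by linarith [hp.1]
  have h₂ : q.2 ≤ q.2 + p.2 := by linarith [hp.2]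
  rw [boxWidth, placedRect, fst_image_prod _ (nonempty_Icc.2 h₂), csSup_Icc h₁, csInf_Icc h₁]
  ring

lemma boxHeight_placedRect {p : Piece} (hp : PiecePos p) (q : ℝ × ℝ) :
    boxHeight (placedRect p q) = p.2 := by
  have h₁ : q.1 ≤ q.1 + p.1 := by linarith [hp.1]
  have h₂ : q.2 ≤ q.2 + p.2 := by linarith [hp.2]
  rw [boxHeight, placedRect, snd_image_prod (nonempty_Icc.2 h₁), csSup_Icc h₂, csInf_Icc h₂]
  ring

lemma interior_placedRect (p : Piece) (q : ℝ × ℝ) :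
    interior (placedRect p q) = Ioo q.1 (q.1 + p.1) ×ˢ Ioo q.2 (q.2 + p.2) := by
  rw [placedRect, interior_prod_eq, interior_Icc, interior_Icc]

lemma disjoint_interior_placedRect {p p' : Piece} {q q' : ℝ × ℝ}
    (h : q.1 + p.1 ≤ q'.1 ∨ q'.1 + p'.1 ≤ q.1 ∨ q.2 + p.2 ≤ q'.2 ∨ q'.2 + p'.2 ≤ q.2) :
    Disjoint (interior (placedRect p q)) (interior (placedRect p' q')) := by
  rw [interior_placedRect, interior_placedRect, Set.disjoint_left]
  rintro ⟨x, y⟩ ⟨⟨h₁, h₂⟩, h₃, h₄⟩ ⟨⟨h₅, h₆⟩, h₇, h₈⟩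
  dsimp only at *
  rcases h with h | h | h | h <;> linarith

lemma volume_le_boxWidth_mul_boxHeight {S : Set (ℝ × ℝ)} (hS : Bornology.IsBounded S) :
    MeasureTheory.volume S ≤ ENNReal.ofReal (boxWidth S * boxHeight S) := by
  have h : S ⊆ Icc (sInf (Prod.fst '' S)) (sSup (Prod.fst '' S)) ×ˢ
      Icc (sInf (Prod.snd '' S)) (sSup (Prod.snd '' S)) := fun z hz =>
    ⟨⟨csInf_le hS.image_fst.bddBelow (mem_image_of_mem _ hz),
      le_csSup hS.image_fst.bddAbove (mem_image_of_mem _ hz)⟩,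
      csInf_le hS.image_snd.bddBelow (mem_image_of_mem _ hz),
      le_csSup hS.image_snd.bddAbove (mem_image_of_mem _ hz)⟩
  refine (MeasureTheory.measure_mono h).trans_eq ?_
  rw [MeasureTheory.Measure.volume_eq_prod, MeasureTheory.Measure.prod_prod, Real.volume_Icc,
    Real.volume_Icc, ENNReal.ofReal_mul (boxWidth_nonneg hS), boxWidth, boxHeight]

/-- Interior-disjoint unit squares occupy at least their number as bounding-box area. -/
lemma card_le_boxWidth_mul_boxHeight {m : ℕ} (q : Fin m → ℝ × ℝ)
    (hq : Pairwise fun i j => Disjoint (interior (placedRect (1, 1) (q i)))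
      (interior (placedRect (1, 1) (q j)))) :
    (m : ℝ) ≤ boxWidth (⋃ i, placedRect (1, 1) (q i)) *
      boxHeight (⋃ i, placedRect (1, 1) (q i)) := by
  have hb : Bornology.IsBounded (⋃ i, placedRect (1, 1) (q i)) :=
    Bornology.isBounded_iUnion.2 fun i => isBounded_placedRect _ _
  have h : MeasureTheory.volume (⋃ i, interior (placedRect (1, 1) (q i))) = m := by
    rw [MeasureTheory.measure_iUnion hq fun i => isOpen_interior.measurableSet]
    simp [interior_placedRect, MeasureTheory.Measure.volume_eq_prod]
  have h' := (MeasureTheory.measure_mono (μ := MeasureTheory.volume)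
    (iUnion_mono fun i => interior_subset)).trans (volume_le_boxWidth_mul_boxHeight hb)
  rw [h, ← ENNReal.ofReal_natCast] at h'
  exact (ENNReal.ofReal_le_ofReal_iff
    (mul_nonneg (boxWidth_nonneg hb) (boxHeight_nonneg hb))).1 h'

lemma isBounded_packedRotSet (L : List Piece) (pos : Fin L.length → ℝ × ℝ)
    (rot : Fin L.length → Bool) : Bornology.IsBounded (packedRotSet L pos rot) :=
  Bornology.isBounded_iUnion.2 fun _ => isBounded_placedRect _ _

lemma areaRotCost_nonneg (L : List Piece) (pos : Fin L.length → ℝ × ℝ)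
    (rot : Fin L.length → Bool) : 0 ≤ areaRotCost L pos rot :=
  mul_nonneg (boxWidth_nonneg (isBounded_packedRotSet L pos rot))
    (boxHeight_nonneg (isBounded_packedRotSet L pos rot))

/-- A packing inside a given box bounds the optimal area. -/
lemma optRotArea_le {L : List Piece} (hL : ∀ p ∈ L, PiecePos p) (hne : L ≠ [])
    (pos : Fin L.length → ℝ × ℝ) (hpack : IsRotPacking L pos fun _ => false) {B : Piece}
    (hB : PiecePos B) (hsub : ∀ i, placedRect (L.get i) (pos i) ⊆ placedRect B 0) :
    optRotArea L ≤ B.1 * B.2 := by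
  have hmem : optRotArea L ≤ areaRotCost L pos fun _ => false :=
    csInf_le ⟨0, by rintro _ ⟨p, r, -, rfl⟩; exact areaRotCost_nonneg L p r⟩ ⟨pos, _, hpack, rfl⟩
  have hsub' : packedRotSet L pos (fun _ => false) ⊆ placedRect B 0 := iUnion_subset hsub
  have hS : (packedRotSet L pos fun _ => false).Nonempty :=
    (placedRect_nonempty (hL _ (L.get_mem ⟨0, List.length_pos_iff.2 hne⟩)) _).mono
      (subset_iUnion (fun i => placedRect (orient (L.get i) false) (pos i)) _)
  have hw := boxWidth_mono hS (isBounded_placedRect B 0) hsub'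
  have hh := boxHeight_mono hS (isBounded_placedRect B 0) hsub'
  rw [boxWidth_placedRect hB] at hw
  rw [boxHeight_placedRect hB] at hh
  exact hmem.trans (mul_le_mul hw hh (boxHeight_nonneg (isBounded_packedRotSet ..)) hB.1.le)

/-! ### Streams of unit squares followed by one piece -/

/-- The stream of `m` unit squares followed by the piece `p`. -/
def unitsThen (m : ℕ) (p : Piece) : List Piece := List.replicate m (1, 1) ++ [p]

lemma length_unitsThen (m : ℕ) (p : Piece) : (unitsThen m p).length = m + 1 := by
  simp [unitsThen]

lemma get_unitsThen (m : ℕ) (p : Piece) (i : Fin (unitsThen m p).length) :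
    (unitsThen m p).get i = if (i : ℕ) < m then (1, 1) else p := by
  split_ifs with hi
  · exact (List.getElem_append_left (by simpa using hi)).trans (List.getElem_replicate _)
  · exact (List.getElem_append_right (by simpa using hi)).trans (List.getElem_singleton _)

lemma one_le_of_mem_unitsThen {m : ℕ} {p q : Piece} (hp : 1 ≤ p.1 ∧ 1 ≤ p.2)
    (hq : q ∈ unitsThen m p) : 1 ≤ q.1 ∧ 1 ≤ q.2 := by
  rw [unitsThen, List.mem_append, List.mem_singleton] at hq
  rcases hq with hq | rfl
  · rw [List.eq_of_mem_replicate hq]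
    exact ⟨le_rfl, le_rfl⟩
  · exact hp

lemma piecePos_of_mem_unitsThen {m : ℕ} {p q : Piece} (hp : 1 ≤ p.1 ∧ 1 ≤ p.2)
    (hq : q ∈ unitsThen m p) : PiecePos q :=
  (one_le_of_mem_unitsThen hp hq).imp one_pos.trans_le one_pos.trans_le

/-- Packing a stream `unitsThen m p` in a given box: the unit squares have distinct integral
positions, all of them on one side of `p`. -/
lemma optRotArea_unitsThen_le {m : ℕ} {p B : Piece} (hp : 1 ≤ p.1 ∧ 1 ≤ p.2)
    (hB : PiecePos B) (f : ℕ → ℕ × ℕ) (hf : f.Injective) (g : ℝ × ℝ)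
    (hfg : ∀ i < m, (f i).1 + 1 ≤ g.1 ∨ (f i).2 + 1 ≤ g.2)
    (hfB : ∀ i < m, (f i).1 + 1 ≤ B.1 ∧ (f i).2 + 1 ≤ B.2)
    (hg : 0 ≤ g.1 ∧ 0 ≤ g.2) (hgB : g.1 + p.1 ≤ B.1 ∧ g.2 + p.2 ≤ B.2) :
    optRotArea (unitsThen m p) ≤ B.1 * B.2 := by
  refine optRotArea_le (fun _ => piecePos_of_mem_unitsThen hp) (by simp [unitsThen])
    (fun i => if (i : ℕ) < m then (((f i).1 : ℝ), ((f i).2 : ℝ)) else g) ?_ hB ?_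
  · intro i j hij
    have hi := i.2.trans_eq (length_unitsThen m p)
    have hj := j.2.trans_eq (length_unitsThen m p)
    have hne : (i : ℕ) ≠ j := fun h => hij (Fin.ext h)
    apply disjoint_interior_placedRect
    simp only [orient, get_unitsThen, Bool.false_eq_true, if_false]
    split_ifs with h₁ h₂ h₂
    · have : (f i).1 + 1 ≤ (f j).1 ∨ (f j).1 + 1 ≤ (f i).1 ∨
          (f i).2 + 1 ≤ (f j).2 ∨ (f j).2 + 1 ≤ (f i).2 := by
        by_contra hc
        exact hne (hf (Prod.ext (by omega) (by omega)))
      dsimp only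
      exact_mod_cast this
    · rcases hfg i h₁ with h | h
      · exact Or.inl h
      · exact Or.inr (Or.inr (Or.inl h))
    · rcases hfg j h₂ with h | h
      · exact Or.inr (Or.inl h)
      · exact Or.inr (Or.inr (Or.inr h))
    · omega
  · intro i
    simp only [get_unitsThen, placedRect]
    split_ifs with h
    · have := hfB i h
      exact prod_mono (Icc_subset_Icc (by simp) (by simpa using this.1))
        (Icc_subset_Icc (by simp) (by simpa using this.2))
    · exact prod_mono (Icc_subset_Icc hg.1 (by simpa using hgB.1))
        (Icc_subset_Icc hg.2 (by simpa using hgB.2))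

lemma optRotArea_unitsThen_bar_le {m : ℕ} (hm : 1 ≤ m) :
    optRotArea (unitsThen m ((m : ℝ), 1)) ≤ 2 * (m : ℝ) := by
  have hm' : (1 : ℝ) ≤ m := by exact_mod_cast hm
  rw [mul_comm]
  refine optRotArea_unitsThen_le (B := ((m : ℝ), 2)) ⟨hm', le_rfl⟩ ⟨by simp; omega, two_pos⟩
    (fun i => (i, 0)) (fun i j h => (Prod.ext_iff.1 h).1) (0, 1) ?_ ?_ ?_ ?_
  · simp
  · intro i hi
    exact ⟨by dsimp only; exact_mod_cast hi, by norm_num⟩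
  · simp
  · norm_num

lemma optRotArea_unitsThen_square_le {n : ℕ} (hn : 1 ≤ n) :
    optRotArea (unitsThen (n ^ 2) ((n : ℝ), (n : ℝ))) ≤ 2 * (n : ℝ) ^ 2 := by
  have hn' : (1 : ℝ) ≤ n := by exact_mod_cast hn
  have hmod : ∀ i : ℕ, ((i % n : ℕ) : ℝ) + 1 ≤ n := fun i => by
    exact_mod_cast Nat.mod_lt i hn
  rw [show 2 * (n : ℝ) ^ 2 = 2 * n * n by ring]
  refine optRotArea_unitsThen_le (B := (2 * (n : ℝ), (n : ℝ))) ⟨hn', hn'⟩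
    ⟨by dsimp only; linarith, by dsimp only; linarith⟩ (fun i => (i % n, i / n)) ?_
    ((n : ℝ), 0) ?_ ?_ ?_ ?_
  · intro i j h
    obtain ⟨h₁, h₂⟩ := Prod.ext_iff.1 h
    dsimp only at h₁ h₂
    rw [← Nat.div_add_mod i n, ← Nat.div_add_mod j n, h₁, h₂]
  · exact fun i _ => Or.inl (hmod i)
  · intro i hi
    refine ⟨by have := hmod i; dsimp only; linarith, ?_⟩
    dsimp only
    exact_mod_cast (Nat.div_lt_iff_lt_mul hn).2 (sq n ▸ hi)
  · exact ⟨by dsimp only; linarith, le_rfl⟩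
  · exact ⟨by dsimp only; linarith, by simp⟩

/-! ### Online strategies on such streams -/

/-- The region covered by the strategy `σ` after `m` unit squares. -/
def unitsRegion (σ : List Piece → (ℝ × ℝ) × Bool) (m : ℕ) : Set (ℝ × ℝ) :=
  ⋃ i : Fin m, placedRect (1, 1) (σ (List.replicate ((i : ℕ) + 1) (1, 1))).1

lemma orient_one_one (r : Bool) : orient (1, 1) r = (1, 1) := by
  cases r <;> rfl

lemma nat_le_area_unitsRegion {σ : List Piece → (ℝ × ℝ) × Bool} (hσ : RotStrategyValid σ)
    (m : ℕ) : (m : ℝ) ≤ boxWidth (unitsRegion σ m) * boxHeight (unitsRegion σ m) := by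
  apply card_le_boxWidth_mul_boxHeight
  intro i j hij
  have h := hσ (List.replicate m (1, 1)) (fun p hp => by
    rw [List.eq_of_mem_replicate hp]; exact ⟨one_pos, one_pos⟩)
    (i.cast (by simp)) (j.cast (by simp)) (by simpa [Fin.ext_iff] using hij)
  simpa [onlineRotPos, orient_one_one, List.take_replicate,
    Nat.min_eq_left (Nat.succ_le_of_lt i.2),
    Nat.min_eq_left (Nat.succ_le_of_lt j.2)] using h

lemma unitsRegion_subset (σ : List Piece → (ℝ × ℝ) × Bool) (m : ℕ) (p : Piece) :
    unitsRegion σ m ⊆ packedRotSet (unitsThen m p) (onlineRotPos σ (unitsThen m p))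
      (onlineRot σ (unitsThen m p)) := by
  refine iUnion_subset fun i => ?_
  have hi : (i : ℕ) < (unitsThen m p).length := by rw [length_unitsThen]; omega
  refine Subset.trans (subset_of_eq ?_) (subset_iUnion _ ⟨i, hi⟩)
  have ht : (unitsThen m p).take ((i : ℕ) + 1) = List.replicate ((i : ℕ) + 1) (1, 1) := by
    rw [unitsThen, List.take_append_of_le_length (by simp), List.take_replicate,
      Nat.min_eq_left (by omega)]
  rw [get_unitsThen, if_pos i.2, orient_one_one, onlineRotPos, ht]

/-- The bounding box of the online packing is at least as large as that of the unit squares and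
as the last piece in one of its orientations. -/
lemma exists_orient_le_algRotArea (σ : List Piece → (ℝ × ℝ) × Bool) {m : ℕ} (hm : 1 ≤ m)
    {p : Piece} (hp : PiecePos p) : ∃ r,
      max (boxWidth (unitsRegion σ m)) (orient p r).1 *
        max (boxHeight (unitsRegion σ m)) (orient p r).2 ≤ algRotArea σ (unitsThen m p) := by
  set L := unitsThen m p
  have hi : m < L.length := by simp [L, length_unitsThen]
  have hb := isBounded_packedRotSet L (onlineRotPos σ L) (onlineRot σ L)
  have hU := unitsRegion_subset σ m p
  have hne : (unitsRegion σ m).Nonempty :=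
    (placedRect_nonempty ⟨one_pos, one_pos⟩ _).mono
      (subset_iUnion (fun i : Fin m => placedRect (1, 1)
        (σ (List.replicate ((i : ℕ) + 1) (1, 1))).1) ⟨0, hm⟩)
  have hP : placedRect (orient p (onlineRot σ L ⟨m, hi⟩)) (onlineRotPos σ L ⟨m, hi⟩) ⊆
      packedRotSet L (onlineRotPos σ L) (onlineRot σ L) := by
    refine Subset.trans (subset_of_eq ?_) (subset_iUnion _ ⟨m, hi⟩)
    rw [get_unitsThen, if_neg (lt_irrefl m)]
  have hpos : PiecePos (orient p (onlineRot σ L ⟨m, hi⟩)) := by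
    cases onlineRot σ L ⟨m, hi⟩
    exacts [hp, hp.symm]
  refine ⟨onlineRot σ L ⟨m, hi⟩, mul_le_mul (max_le (boxWidth_mono hne hb hU) ?_)
    (max_le (boxHeight_mono hne hb hU) ?_) (hpos.2.le.trans (le_max_right _ _))
    (boxWidth_nonneg hb)⟩
  · rw [← boxWidth_placedRect hpos (onlineRotPos σ L ⟨m, hi⟩)]
    exact boxWidth_mono (placedRect_nonempty hpos _) hb hP
  · rw [← boxHeight_placedRect hpos (onlineRotPos σ L ⟨m, hi⟩)]
    exact boxHeight_mono (placedRect_nonempty hpos _) hb hP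

/-- For every valid online rotation strategy `σ` and every
integer `n ≥ 1`, there exists a stream `L` of `n² + 1` pieces, each with both
edge lengths at least 1, such that `OPT(L) ≤ 2n²` and `ALG_σ(L) ≥ n^(5/2)`
(area of the bounding box, rotations by 90° allowed). -/
theorem area_rotation_fourth_root_opt_lower_bound
    (σ : List Piece → (ℝ × ℝ) × Bool) (hσ : RotStrategyValid σ)
    (n : ℕ) (hn : 1 ≤ n) :
    ∃ L : List Piece, L.length = n ^ 2 + 1 ∧ (∀ q ∈ L, 1 ≤ q.1 ∧ 1 ≤ q.2) ∧
      optRotArea L ≤ 2 * (n : ℝ) ^ 2 ∧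
      (n : ℝ) ^ ((5 : ℝ) / 2) ≤ algRotArea σ L := by
  have hn' : (1 : ℝ) ≤ n := by exact_mod_cast hn
  have hm : 1 ≤ n ^ 2 := Nat.one_le_pow _ _ hn
  set s := √(n : ℝ) with hs
  have hs0 : 0 < s := Real.sqrt_pos.2 (by linarith)
  have hss : s * s = n := Real.mul_self_sqrt (by linarith)
  have hpow : (n : ℝ) ^ ((5 : ℝ) / 2) = n ^ 2 * s := by
    rw [hs, Real.sqrt_eq_rpow, ← Real.rpow_natCast, ← Real.rpow_add (by linarith)]
    norm_num
  have hA := nat_le_area_unitsRegion hσ (n ^ 2)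
  push_cast at hA
  set a := boxWidth (unitsRegion σ (n ^ 2))
  set b := boxHeight (unitsRegion σ (n ^ 2))
  have hub : Bornology.IsBounded (unitsRegion σ (n ^ 2)) :=
    Bornology.isBounded_iUnion.2 fun _ => isBounded_placedRect _ _
  have ha : 0 ≤ a := boxWidth_nonneg hub
  have hb : 0 ≤ b := boxHeight_nonneg hub
  rw [hpow]
  by_cases hab : s ≤ a ∧ s ≤ b
  · refine ⟨unitsThen (n ^ 2) (((n ^ 2 : ℕ) : ℝ), 1), length_unitsThen _ _, fun q hq =>
      one_le_of_mem_unitsThen ⟨by dsimp only; exact_mod_cast hm, le_rfl⟩ hq,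
      by simpa using optRotArea_unitsThen_bar_le hm, ?_⟩
    obtain ⟨r, hr⟩ := exists_orient_le_algRotArea σ hm (p := (((n ^ 2 : ℕ) : ℝ), 1))
      ⟨Nat.cast_pos.2 hm, one_pos⟩
    refine le_trans ?_ hr
    push_cast
    cases r
    · exact mul_le_mul (le_max_right _ _) (hab.2.trans (le_max_left _ _)) hs0.le
        (ha.trans (le_max_left _ _))
    · rw [mul_comm]
      exact mul_le_mul (hab.1.trans (le_max_left _ _)) (le_max_right _ _) (by positivity)
        (ha.trans (le_max_left _ _))
  · refine ⟨unitsThen (n ^ 2) ((n : ℝ), (n : ℝ)), length_unitsThen _ _, fun q hq =>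
      one_le_of_mem_unitsThen ⟨hn', hn'⟩ hq, optRotArea_unitsThen_square_le hn, ?_⟩
    obtain ⟨r, hr⟩ := exists_orient_le_algRotArea σ hm (p := ((n : ℝ), (n : ℝ)))
      ⟨by dsimp only; linarith, by dsimp only; linarith⟩
    have hor : orient ((n : ℝ), (n : ℝ)) r = ((n : ℝ), (n : ℝ)) := by cases r <;> rfl
    rw [hor] at hr
    refine le_trans ?_ hr
    have hlong : ∀ x y : ℝ, 0 ≤ x → y < s → (n : ℝ) ^ 2 ≤ x * y → n * s ≤ x := by
      intro x y hx hy hxy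
      have : n * s * s ≤ x * s := by
        calc n * s * s = (n : ℝ) ^ 2 := by rw [mul_assoc, hss, sq]
          _ ≤ x * s := hxy.trans (mul_le_mul_of_nonneg_left hy.le hx)
      exact le_of_mul_le_mul_right this hs0
    rcases not_and_or.1 hab with h | h
    · have := hlong b a hb (not_le.1 h) (by linarith)
      calc (n : ℝ) ^ 2 * s = n * (n * s) := by ring
        _ ≤ _ := mul_le_mul (le_max_right _ _) (this.trans (le_max_left _ _)) (by positivity)
          (ha.trans (le_max_left _ _))
    · have := hlong a b ha (not_le.1 h) hA
      calc (n : ℝ) ^ 2 * s = n * s * n := by ring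
        _ ≤ _ := mul_le_mul (this.trans (le_max_left _ _)) (le_max_right _ _) (by positivity)
          (ha.trans (le_max_left _ _))
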